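/- Let C be a unital b-category with induced braiding c, and define the associator α_{X,Y,Z} := c_{Z,X⊗Y} ∘ β_{Z,X,Y}^{-1} ∘ (1_X ⊗ c_{Z,Y}^{-1}) : X⊗(Y⊗Z) → (X⊗Y)⊗Z. Then α satisfies the pentagon axiom: for all objects X, Y, Z, W, α_{X⊗Y,Z,W} ∘ α_{X,Y,Z⊗W} = (α_{X,Y,Z} ⊗ 1_W) ∘ α_{X,Y⊗Z,W} ∘ (1_X ⊗ α_{Y,Z,W}) as morphisms X⊗(Y⊗(Z⊗W)) → ((X⊗Y)⊗Z)⊗W. -/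

import Mathlib

open CategoryTheory

universe v u

/-- A b-category: a category with a tensor product functor `⊗ : C × C → C` and a
natural family of isomorphisms `β_{X,Y,Z} : X⊗(Y⊗Z) ≅ Y⊗(X⊗Z)` satisfying the
permutohedron coherence. -/
structure BCat (C : Type u) [Category.{v} C] where
  tensorObj : C → C → C
  tensorHom : ∀ {X₁ Y₁ X₂ Y₂ : C}, (X₁ ⟶ Y₁) → (X₂ ⟶ Y₂) →
    (tensorObj X₁ X₂ ⟶ tensorObj Y₁ Y₂)
  tensorHom_id : ∀ (X Y : C), tensorHom (𝟙 X) (𝟙 Y) = 𝟙 (tensorObj X Y)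
  tensorHom_comp : ∀ {X₁ Y₁ Z₁ X₂ Y₂ Z₂ : C} (f₁ : X₁ ⟶ Y₁) (g₁ : Y₁ ⟶ Z₁)
    (f₂ : X₂ ⟶ Y₂) (g₂ : Y₂ ⟶ Z₂),
    tensorHom (f₁ ≫ g₁) (f₂ ≫ g₂) = tensorHom f₁ f₂ ≫ tensorHom g₁ g₂
  β : ∀ (X Y Z : C), tensorObj X (tensorObj Y Z) ≅ tensorObj Y (tensorObj X Z)
  β_natural : ∀ {X₁ Y₁ X₂ Y₂ X₃ Y₃ : C} (f : X₁ ⟶ Y₁) (g : X₂ ⟶ Y₂) (h : X₃ ⟶ Y₃),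
    tensorHom f (tensorHom g h) ≫ (β Y₁ Y₂ Y₃).hom
      = (β X₁ X₂ X₃).hom ≫ tensorHom g (tensorHom f h)
  b_coherence : ∀ (X Y Z W : C),
    tensorHom (𝟙 X) (β Y Z W).hom ≫ (β X Z (tensorObj Y W)).hom
        ≫ tensorHom (𝟙 Z) (β X Y W).hom
      = (β X Y (tensorObj Z W)).hom ≫ tensorHom (𝟙 Y) (β X Z W).hom
        ≫ (β Y Z (tensorObj X W)).hom

/-- A unital b-category: a b-category with a unit object `I` and a natural family
of isomorphisms `ρ_X : X ⊗ I ≅ X`, required (below) to satisfy the unit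
coherence `UnitCoh` and the mixed coherence `MixedCoh`. -/
structure UBCat (C : Type u) [Category.{v} C] extends BCat C where
  unit : C
  ρ : ∀ X : C, tensorObj X unit ≅ X
  ρ_natural : ∀ {X Y : C} (f : X ⟶ Y),
    tensorHom f (𝟙 unit) ≫ (ρ Y).hom = (ρ X).hom ≫ f

variable {C : Type u} [Category.{v} C]

/-- Tensoring an isomorphism with an identity on the left, as an isomorphism. -/
def UBCat.idTensor (B : UBCat C) (X : C) {Y Y' : C} (e : Y ≅ Y') :
    B.tensorObj X Y ≅ B.tensorObj X Y' where
  hom := B.tensorHom (𝟙 X) e.hom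
  inv := B.tensorHom (𝟙 X) e.inv
  hom_inv_id := by rw [← B.tensorHom_comp]; simp [B.tensorHom_id]
  inv_hom_id := by rw [← B.tensorHom_comp]; simp [B.tensorHom_id]

/-- The induced braiding `c_{X,Y} = (1_Y ⊗ ρ_X) ∘ β_{X,Y,I} ∘ (1_X ⊗ ρ_Y⁻¹)`
of a unital b-category. -/
def UBCat.c (B : UBCat C) (X Y : C) : B.tensorObj X Y ≅ B.tensorObj Y X :=
  B.idTensor X (B.ρ Y).symm ≪≫ B.β X Y B.unit ≪≫ B.idTensor Y (B.ρ X)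

/-- The unit coherence of a unital b-category:
`c_{X⊗Y,I} ∘ ρ_{X⊗Y}⁻¹ = β_{X,I,Y} ∘ (1_X ⊗ c_{Y,I}) ∘ (1_X ⊗ ρ_Y⁻¹)`. -/
def UBCat.UnitCoh (B : UBCat C) : Prop :=
  ∀ X Y : C,
    (B.ρ (B.tensorObj X Y)).inv ≫ (B.c (B.tensorObj X Y) B.unit).hom
      = B.tensorHom (𝟙 X) (B.ρ Y).inv ≫ B.tensorHom (𝟙 X) (B.c Y B.unit).hom
          ≫ (B.β X B.unit Y).hom

/-- The mixed coherence of a unital b-category: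
`(1_X ⊗ c_{Z⊗W,Y}) ∘ β_{Z⊗W,X,Y} ∘ c_{X⊗Y,Z⊗W}
  = (1_X ⊗ β_{Z,Y,W}) ∘ (1_X ⊗ (1_Z ⊗ c_{W,Y})) ∘ β_{Z,X,W⊗Y} ∘ (1_Z ⊗ β_{W,X,Y})
      ∘ (1_Z ⊗ c_{X⊗Y,W}) ∘ β_{X⊗Y,Z,W}`. -/
def UBCat.MixedCoh (B : UBCat C) : Prop :=
  ∀ X Y Z W : C,
    (B.c (B.tensorObj X Y) (B.tensorObj Z W)).hom ≫ (B.β (B.tensorObj Z W) X Y).hom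
        ≫ B.tensorHom (𝟙 X) (B.c (B.tensorObj Z W) Y).hom
      = (B.β (B.tensorObj X Y) Z W).hom
          ≫ B.tensorHom (𝟙 Z) (B.c (B.tensorObj X Y) W).hom
          ≫ B.tensorHom (𝟙 Z) (B.β W X Y).hom
          ≫ (B.β Z X (B.tensorObj W Y)).hom
          ≫ B.tensorHom (𝟙 X) (B.tensorHom (𝟙 Z) (B.c W Y).hom)
          ≫ B.tensorHom (𝟙 X) (B.β Z Y W).hom

namespace UBCat

variable (B : UBCat C)

lemma idTensor_comp (X : C) {Y Y' Y'' : C} (f : Y ⟶ Y') (g : Y' ⟶ Y'') :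
    B.tensorHom (𝟙 X) (f ≫ g) = B.tensorHom (𝟙 X) f ≫ B.tensorHom (𝟙 X) g := by
  rw [← B.tensorHom_comp, Category.comp_id]

instance isIso_idTensor (X : C) {Y Y' : C} (f : Y ⟶ Y') [IsIso f] :
    IsIso (B.tensorHom (𝟙 X) f) :=
  (B.idTensor X (asIso f)).isIso_hom

lemma β_natural_left {X X' : C} (f : X ⟶ X') (Y Z : C) :
    B.tensorHom f (𝟙 (B.tensorObj Y Z)) ≫ (B.β X' Y Z).hom
      = (B.β X Y Z).hom ≫ B.tensorHom (𝟙 Y) (B.tensorHom f (𝟙 Z)) := by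
  rw [← B.tensorHom_id, B.β_natural]

lemma β_natural_right (X Y : C) {Z Z' : C} (f : Z ⟶ Z') :
    B.tensorHom (𝟙 X) (B.tensorHom (𝟙 Y) f) ≫ (B.β X Y Z').hom
      = (B.β X Y Z).hom ≫ B.tensorHom (𝟙 Y) (B.tensorHom (𝟙 X) f) :=
  B.β_natural _ _ _

/-- The defining relation between the induced braiding and `β`, free of inverses. -/
lemma idTensor_ρ_comp_c (X Y : C) :
    B.tensorHom (𝟙 X) (B.ρ Y).hom ≫ (B.c X Y).hom
      = (B.β X Y B.unit).hom ≫ B.tensorHom (𝟙 Y) (B.ρ X).hom :=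
  (B.idTensor X (B.ρ Y)).hom_inv_id_assoc _

lemma c_natural {X X' Y Y' : C} (f : X ⟶ X') (g : Y ⟶ Y') :
    B.tensorHom f g ≫ (B.c X' Y').hom = (B.c X Y).hom ≫ B.tensorHom g f := by
  rw [← cancel_epi (B.tensorHom (𝟙 X) (B.ρ Y).hom), ← Category.assoc, ← B.tensorHom_comp,
    Category.id_comp, ← B.ρ_natural, ← Category.comp_id f, B.tensorHom_comp, Category.assoc,
    idTensor_ρ_comp_c, ← Category.assoc, B.β_natural, reassoc_of% B.idTensor_ρ_comp_c,
    Category.assoc, ← B.tensorHom_comp, ← B.tensorHom_comp, B.ρ_natural, Category.comp_id,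
    Category.id_comp, Category.comp_id]

lemma c_hexagon (X Y Z : C) :
    B.tensorHom (𝟙 X) (B.c Y Z).hom ≫ (B.β X Z Y).hom ≫ B.tensorHom (𝟙 Z) (B.c X Y).hom
      = (B.β X Y Z).hom ≫ B.tensorHom (𝟙 Y) (B.c X Z).hom ≫ (B.β Y Z X).hom := by
  rw [← cancel_epi (B.tensorHom (𝟙 X) (B.tensorHom (𝟙 Y) (B.ρ Z).hom))]
  calc
    _ = (B.tensorHom (𝟙 X) (B.β Y Z B.unit).hom ≫ (B.β X Z _).hom ≫
          B.tensorHom (𝟙 Z) (B.β X Y B.unit).hom) ≫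
          B.tensorHom (𝟙 Z) (B.tensorHom (𝟙 Y) (B.ρ X).hom) := by
      simp only [Category.assoc]
      rw [← B.idTensor_comp, ← B.idTensor_ρ_comp_c, B.idTensor_comp,
        ← reassoc_of% B.β_natural_right, ← reassoc_of% B.idTensor_comp X,
        ← reassoc_of% B.idTensor_comp X, B.idTensor_ρ_comp_c]
    _ = _ := by
      rw [B.b_coherence, reassoc_of% B.β_natural_right, ← reassoc_of% B.idTensor_comp Y,
        B.idTensor_ρ_comp_c, B.idTensor_comp]
      simp only [Category.assoc]
      rw [B.β_natural_right]

variable {B}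

/-- The double braiding of `P` with `Z ⊗ W` factors through those with `Z` and `W`. -/
lemma c_comp_c (h₁ : B.UnitCoh) (h₂ : B.MixedCoh) (P Z W : C) :
    (B.c P (B.tensorObj Z W)).hom ≫ (B.c (B.tensorObj Z W) P).hom
      = (B.β P Z W).hom ≫ B.tensorHom (𝟙 Z) (B.c P W).hom ≫ B.tensorHom (𝟙 Z) (B.c W P).hom
          ≫ (B.β Z P W).hom := by
  have h_left : B.tensorHom (B.ρ P).hom (𝟙 _) ≫ (B.c P (B.tensorObj Z W)).hom
      ≫ (B.c (B.tensorObj Z W) P).hom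
      = (B.c (B.tensorObj P B.unit) (B.tensorObj Z W)).hom ≫ (B.β (B.tensorObj Z W) P B.unit).hom
        ≫ B.tensorHom (𝟙 P) (B.ρ (B.tensorObj Z W)).hom := by
    rw [reassoc_of% B.c_natural, idTensor_ρ_comp_c]
  have h_right : B.tensorHom (B.ρ P).hom (𝟙 _) ≫ (B.β P Z W).hom
      ≫ B.tensorHom (𝟙 Z) (B.c P W).hom ≫ B.tensorHom (𝟙 Z) (B.c W P).hom ≫ (B.β Z P W).hom
      = (B.β (B.tensorObj P B.unit) Z W).hom
        ≫ B.tensorHom (𝟙 Z) (B.c (B.tensorObj P B.unit) W).hom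
        ≫ B.tensorHom (𝟙 Z) (B.β W P B.unit).hom ≫ (B.β Z P (B.tensorObj W B.unit)).hom
        ≫ B.tensorHom (𝟙 P) (B.tensorHom (𝟙 Z) (B.ρ W).hom) := by
    rw [reassoc_of% B.β_natural_left, ← reassoc_of% B.idTensor_comp Z, B.c_natural,
      ← reassoc_of% B.idTensor_comp Z, Category.assoc, B.idTensor_ρ_comp_c]
    simp only [B.idTensor_comp, Category.assoc]
    rw [B.β_natural_right]
  have : IsIso (B.tensorHom (B.ρ P).hom (𝟙 (B.tensorObj Z W))) :=
    ⟨B.tensorHom (B.ρ P).inv (𝟙 _), by simp [← B.tensorHom_comp, B.tensorHom_id],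
      by simp [← B.tensorHom_comp, B.tensorHom_id]⟩
  have h_unit : B.tensorHom (𝟙 Z) (B.ρ W).hom ≫ (B.ρ (B.tensorObj Z W)).inv
      ≫ (B.c (B.tensorObj Z W) B.unit).hom
      = B.tensorHom (𝟙 Z) (B.c W B.unit).hom ≫ (B.β Z B.unit W).hom := by
    rw [h₁, ← reassoc_of% B.idTensor_comp, Iso.hom_inv_id, B.tensorHom_id, Category.id_comp]
  rw [← cancel_epi (B.tensorHom (B.ρ P).hom (𝟙 (B.tensorObj Z W))), h_left, h_right,
    ← cancel_mono (B.tensorHom (𝟙 P) ((B.ρ (B.tensorObj Z W)).inv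
      ≫ (B.c (B.tensorObj Z W) B.unit).hom))]
  simp only [Category.assoc, ← B.idTensor_comp P]
  rw [h_unit, Iso.hom_inv_id_assoc, h₂]
  simp only [B.idTensor_comp]

end UBCat

/-- in a unital b-category, the associator
`α_{X,Y,Z} = c_{Z,X⊗Y} ∘ β_{Z,X,Y}⁻¹ ∘ (1_X ⊗ c_{Z,Y}⁻¹) : X⊗(Y⊗Z) → (X⊗Y)⊗Z`
satisfies the pentagon axiom
`α_{X⊗Y,Z,W} ∘ α_{X,Y,Z⊗W} = (α_{X,Y,Z} ⊗ 1_W) ∘ α_{X,Y⊗Z,W} ∘ (1_X ⊗ α_{Y,Z,W})`. -/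
theorem ubcat_pentagon (B : UBCat C) (h₁ : B.UnitCoh) (h₂ : B.MixedCoh)
    (a : ∀ X Y Z : C, B.tensorObj X (B.tensorObj Y Z) ⟶ B.tensorObj (B.tensorObj X Y) Z)
    (ha : ∀ X Y Z : C,
      a X Y Z = B.tensorHom (𝟙 X) (B.c Z Y).inv ≫ (B.β Z X Y).inv
        ≫ (B.c Z (B.tensorObj X Y)).hom)
    (X Y Z W : C) :
    a X Y (B.tensorObj Z W) ≫ a (B.tensorObj X Y) Z W
      = B.tensorHom (𝟙 X) (a Y Z W) ≫ a X (B.tensorObj Y Z) W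
          ≫ B.tensorHom (a X Y Z) (𝟙 W) := by
  have h_assoc : ∀ X Y Z : C, (B.β Z X Y).hom ≫ B.tensorHom (𝟙 X) (B.c Z Y).hom ≫ a X Y Z
      = (B.c Z (B.tensorObj X Y)).hom := by
    intro X Y Z
    rw [ha, ← reassoc_of% B.idTensor_comp X, Iso.hom_inv_id, B.tensorHom_id, Category.id_comp,
      Iso.hom_inv_id_assoc]
  have h_mixed : B.tensorHom (𝟙 Z) (B.β W X Y).hom ≫ (B.β Z X (B.tensorObj W Y)).hom
      ≫ B.tensorHom (𝟙 X) (B.tensorHom (𝟙 Z) (B.c W Y).hom) ≫ B.tensorHom (𝟙 X) (B.β Z Y W).hom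
      ≫ a X Y (B.tensorObj Z W)
      = B.tensorHom (𝟙 Z) (B.c W (B.tensorObj X Y)).hom ≫ (B.β Z (B.tensorObj X Y) W).hom := by
    rw [← cancel_epi (B.tensorHom (𝟙 Z) (B.c (B.tensorObj X Y) W).hom),
      ← cancel_epi (B.β (B.tensorObj X Y) Z W).hom, ← UBCat.c_comp_c h₁ h₂, ← h_assoc X Y (B.tensorObj Z W)]
    have := h₂ X Y Z W =≫ a X Y (B.tensorObj Z W)
    simpa only [Category.assoc] using this.symm
  have h_perm : B.tensorHom (𝟙 W) (B.β Z X Y).hom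
      ≫ B.tensorHom (𝟙 W) (B.tensorHom (𝟙 X) (B.c Z Y).hom) ≫ (B.β W X (B.tensorObj Y Z)).hom
      ≫ B.tensorHom (𝟙 X) (B.β W Y Z).hom ≫ B.tensorHom (𝟙 X) (B.tensorHom (𝟙 Y) (B.c W Z).hom)
      = (B.β W Z (B.tensorObj X Y)).hom ≫ B.tensorHom (𝟙 Z) (B.β W X Y).hom
        ≫ (B.β Z X (B.tensorObj W Y)).hom ≫ B.tensorHom (𝟙 X) (B.tensorHom (𝟙 Z) (B.c W Y).hom)
        ≫ B.tensorHom (𝟙 X) (B.β Z Y W).hom := by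
    rw [reassoc_of% B.β_natural_right, ← B.idTensor_comp X, ← B.idTensor_comp X, B.c_hexagon,
      B.idTensor_comp, B.idTensor_comp, reassoc_of% B.b_coherence]
  have h_right : B.tensorHom (𝟙 W) (B.β Z X Y).hom
      ≫ B.tensorHom (𝟙 W) (B.tensorHom (𝟙 X) (B.c Z Y).hom) ≫ (B.β W X (B.tensorObj Y Z)).hom
      ≫ B.tensorHom (𝟙 X) (B.β W Y Z).hom ≫ B.tensorHom (𝟙 X) (B.tensorHom (𝟙 Y) (B.c W Z).hom)
      ≫ B.tensorHom (𝟙 X) (a Y Z W) ≫ a X (B.tensorObj Y Z) W ≫ B.tensorHom (a X Y Z) (𝟙 W)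
      = B.tensorHom (𝟙 W) (B.c Z (B.tensorObj X Y)).hom
        ≫ (B.c W (B.tensorObj (B.tensorObj X Y) Z)).hom := by
    rw [← reassoc_of% B.idTensor_comp X, ← reassoc_of% B.idTensor_comp X, Category.assoc, h_assoc,
      reassoc_of% h_assoc, ← B.c_natural, ← reassoc_of% B.idTensor_comp W,
      ← reassoc_of% B.idTensor_comp W, Category.assoc, h_assoc]
  rw [← cancel_epi (B.tensorHom (𝟙 W) (B.β Z X Y).hom
    ≫ B.tensorHom (𝟙 W) (B.tensorHom (𝟙 X) (B.c Z Y).hom) ≫ (B.β W X (B.tensorObj Y Z)).hom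
    ≫ B.tensorHom (𝟙 X) (B.β W Y Z).hom ≫ B.tensorHom (𝟙 X) (B.tensorHom (𝟙 Y) (B.c W Z).hom))]
  simp only [Category.assoc]
  rw [h_right, reassoc_of% h_perm, reassoc_of% h_mixed, ← reassoc_of% B.c_hexagon, h_assoc]
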